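/- Suppose < is a left-invariant linear order on the group H = ⟨x, y | (x⁻²y²)³ = x⁵ = y⁵⟩. Then for every w ∈ H and every integer m ≥ 1, the element w·xᵐ·w⁻¹ has the same sign as x (that is, 1 < x implies 1 < w·xᵐ·w⁻¹, and x < 1 implies w·xᵐ·w⁻¹ < 1); likewise w·yᵐ·w⁻¹ has the same sign as y. -/

import Mathlib

/-- The two generators of the group `H`. -/
inductive XY : Type
  | x | y
  deriving DecidableEq

open FreeGroup in
/-- The relators `(x⁻²y²)³·x⁻⁵` and `x⁵·y⁻⁵` of the presentation of `H`. -/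
def hRels : Set (FreeGroup XY) :=
  { (((of XY.x)⁻¹) ^ 2 * (of XY.y) ^ 2) ^ 3 * ((of XY.x) ^ 5)⁻¹,
    (of XY.x) ^ 5 * ((of XY.y) ^ 5)⁻¹ }

/-- The group `H = ⟨x, y ∣ (x⁻²y²)³ = x⁵ = y⁵⟩`. -/
abbrev H : Type := PresentedGroup hRels

/-- The image of the generator `x` in `H`. -/
def hx : H := PresentedGroup.of XY.x
/-- The image of the generator `y` in `H`. -/
def hy : H := PresentedGroup.of XY.y

/-- `lt` is a left-invariant linear (strict total) order on the group `G`. -/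
def IsLeftInvariantLinearOrder (G : Type*) [Group G] (lt : G → G → Prop) : Prop :=
  IsStrictTotalOrder G lt ∧ ∀ f g h : G, lt g h → lt (f * g) (f * h)

theorem aux_pow_sign {G : Type*} [Group G] {lt : G → G → Prop}
    (hlt : IsLeftInvariantLinearOrder G lt) (g : G) (n : ℕ) :
    (lt 1 g → lt 1 (g ^ (n+1))) ∧ (lt g 1 → lt (g ^ (n+1)) 1) := by
  obtain ⟨hs, hl⟩ := hlt
  induction n with
  | zero => simp
  | succ k ih =>
    constructor
    · intro h
      have h1 := hl (g ^ (k+1)) 1 g h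
      rw [mul_one, ← pow_succ] at h1
      exact _root_.trans (ih.1 h) h1
    · intro h
      have h1 := hl (g ^ (k+1)) g 1 h
      rw [mul_one, ← pow_succ] at h1
      exact _root_.trans h1 (ih.2 h)

theorem aux_conj_sign {G : Type*} [Group G] {lt : G → G → Prop}
    (hlt : IsLeftInvariantLinearOrder G lt) (a w : G) (hc : w * a ^ 5 = a ^ 5 * w)
    (m : ℕ) (hm : 1 ≤ m) :
    (lt 1 a → lt 1 (w * a ^ m * w⁻¹)) ∧ (lt a 1 → lt (w * a ^ m * w⁻¹) 1) := by
  obtain ⟨n, rfl⟩ : ∃ n, m = n + 1 := ⟨m - 1, by omega⟩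
  have hs := hlt.1
  have key : (w * a ^ (n+1) * w⁻¹) ^ 5 = (a ^ (n+1)) ^ 5 := by
    rw [conj_pow, ← pow_mul, mul_comm, pow_mul]
    have h : Commute w ((a ^ 5) ^ (n+1)) := Commute.pow_right hc _
    rw [h.eq, mul_inv_cancel_right]
  have p := aux_pow_sign hlt a n
  have q := aux_pow_sign hlt (a ^ (n+1)) 4
  have r := aux_pow_sign hlt (w * a ^ (n+1) * w⁻¹) 4
  norm_num only at q r
  rw [key] at r
  constructor
  · intro h
    have h5 := q.1 (p.1 h)
    rcases trichotomous_of lt 1 (w * a ^ (n+1) * w⁻¹) with h1 | h1 | h1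
    · exact h1
    · rw [← key, ← h1, one_pow] at h5
      exact absurd h5 (irrefl _)
    · exact absurd (_root_.trans h5 (r.2 h1)) (irrefl _)
  · intro h
    have h5 := q.2 (p.2 h)
    rcases trichotomous_of lt 1 (w * a ^ (n+1) * w⁻¹) with h1 | h1 | h1
    · exact absurd (_root_.trans h5 (r.1 h1)) (irrefl _)
    · rw [← key, ← h1, one_pow] at h5
      exact absurd h5 (irrefl _)
    · exact h1

theorem aux_xy : hx ^ 5 = hy ^ 5 := by
  have h : (PresentedGroup.mk hRels) (FreeGroup.of XY.x ^ 5 * (FreeGroup.of XY.y ^ 5)⁻¹) = 1 :=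
    PresentedGroup.one_of_mem (Or.inr rfl)
  rw [map_mul, map_inv, map_pow, map_pow] at h
  exact mul_inv_eq_one.1 h

theorem aux_central (w : H) : w * hx ^ 5 = hx ^ 5 * w := by
  have hw : w ∈ Subgroup.centralizer {hx ^ 5} := by
    have hle : Subgroup.closure (Set.range (PresentedGroup.of (rels := hRels))) ≤
        Subgroup.centralizer {hx ^ 5} := by
      rw [Subgroup.closure_le]
      rintro _ ⟨i, rfl⟩
      rw [SetLike.mem_coe, Subgroup.mem_centralizer_singleton_iff]
      cases i
      · exact ((Commute.refl hx).pow_right 5).eq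
      · rw [aux_xy]
        exact ((Commute.refl hy).pow_right 5).eq
    rw [PresentedGroup.closure_range_of] at hle
    exact hle trivial
  exact (Subgroup.mem_centralizer_singleton_iff.1 hw)

/-- For a left-invariant linear order on `H`, conjugates of positive powers of
`x` (resp. `y`) have the same sign as `x` (resp. `y`). -/
theorem conj_pow_same_sign (lt : H → H → Prop)
    (hlt : IsLeftInvariantLinearOrder H lt) (w : H) (m : ℕ) (hm : 1 ≤ m) :
    (lt 1 hx → lt 1 (w * hx ^ m * w⁻¹)) ∧ (lt hx 1 → lt (w * hx ^ m * w⁻¹) 1) ∧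
    (lt 1 hy → lt 1 (w * hy ^ m * w⁻¹)) ∧ (lt hy 1 → lt (w * hy ^ m * w⁻¹) 1) := by
  have hX := aux_conj_sign hlt hx w (aux_central w) m hm
  have hY := aux_conj_sign hlt hy w (aux_xy ▸ aux_central w) m hm
  exact ⟨hX.1, hX.2, hY.1, hY.2⟩
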